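/- Let C > 0 and a₀ > 0, let M ≥ 2 be an integer, set T = 1/(4·C·a₀) and τ = T/M. Suppose (aₙ)ₙ is a sequence of nonnegative real numbers starting from a₀ such that for every n < M one has a_{n+1}² ≤ aₙ² + C·τ·aₙ·a_{n+1}². Then aₙ ≤ 4·a₀ for every n ≤ M. -/

import Mathlib

/-- If `x ≤ D / k` and `y² ≤ x² + (x / D) y²`, then `y ≤ D / (k - 1)`, in cleared form. -/
lemma mul_sub_one_le_of_sq_le {D k x y : ℝ} (hD : 0 < D) (hk : 1 ≤ k) (hx : 0 ≤ x)
    (hxk : x * k ≤ D) (h : D * y ^ 2 ≤ D * x ^ 2 + x * y ^ 2) :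
    y * (k - 1) ≤ D := by
  have hsq : (x * k) ^ 2 ≤ D ^ 2 := pow_le_pow_left₀ (by positivity) hxk 2
  have hlin : x * k * (k * y ^ 2) ≤ D * (k * y ^ 2) :=
    mul_le_mul_of_nonneg_right hxk (by positivity)
  have hmul : D * (k * (k - 1) * y ^ 2) ≤ D * D ^ 2 := by
    have h₁ := mul_le_mul_of_nonneg_right h (sq_nonneg k)
    have h₂ := mul_le_mul_of_nonneg_left hsq hD.le
    linarith
  have hdiv : k * (k - 1) * y ^ 2 ≤ D ^ 2 := le_of_mul_le_mul_left hmul hD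
  refine abs_le_of_sq_le_sq' ?_ hD.le |>.2
  nlinarith [mul_nonneg (sub_nonneg.2 hk) (sq_nonneg y)]

/-- Discrete Gronwall-type iteration underlying the unconditional `H^s`-stability
of the semi-implicit scheme (Theorem 1.1(ii)). -/
theorem stmt_0 (C a₀ : ℝ) (hC : 0 < C) (ha₀ : 0 < a₀) (M : ℕ) (hM : 2 ≤ M)
    (T τ : ℝ) (hT : T = 1 / (4 * C * a₀)) (hτ : τ = T / M)
    (a : ℕ → ℝ) (hnn : ∀ n, 0 ≤ a n) (h0 : a 0 = a₀)
    (hrec : ∀ n < M, (a (n + 1)) ^ 2 ≤ (a n) ^ 2 + C * τ * a n * (a (n + 1)) ^ 2) :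
    ∀ n ≤ M, a n ≤ 4 * a₀ := by
  have hM' : (2 : ℝ) ≤ M := by exact_mod_cast hM
  have hD : 0 < 4 * M * a₀ := by positivity
  have hCτ : 4 * M * a₀ * (C * τ) = 1 := by
    rw [hτ, hT]
    field_simp
  have key : ∀ n ≤ M, a n * (4 * M - n) ≤ 4 * M * a₀ := by
    intro n
    induction n with
    | zero => intro _; rw [h0]; push_cast; linarith
    | succ n ih =>
      intro hn
      have hn' : (n : ℝ) + 1 ≤ M := by exact_mod_cast hn
      have hstep : 4 * M * a₀ * a (n + 1) ^ 2 ≤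
          4 * M * a₀ * a n ^ 2 + a n * a (n + 1) ^ 2 := by
        have h := mul_le_mul_of_nonneg_left (hrec n hn) hD.le
        linear_combination h + a n * a (n + 1) ^ 2 * hCτ
      have h := mul_sub_one_le_of_sq_le hD (by linarith) (hnn n) (ih (by omega)) hstep
      push_cast
      linarith
  intro n hn
  have hn' : (n : ℝ) ≤ M := by exact_mod_cast hn
  have hM_pos : (0 : ℝ) < M := by linarith
  refine le_of_mul_le_mul_right ?_ hM_pos
  have h₁ : a n * M ≤ a n * (4 * M - n) :=
    mul_le_mul_of_nonneg_left (by linarith) (hnn n)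
  linarith [key n hn]
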